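/- Let α ∈ (0, 1) and τ₀ > 0, and define the nonlinear relaxation-time profile τ(s) = τ₀ · E_α(−(s/τ₀)^α) / ((s/τ₀)^{α−1} E_{α,α}(−(s/τ₀)^α)) for s > 0. Then τ(s) is a well-defined, finite, strictly positive real number for every s > 0. -/

import Mathlib

/-- The two-parameter Mittag-Leffler function `E_{α,β}(x) = ∑ x ^ k / Γ(α k + β)`
for real `x`. The classical Mittag-Leffler function is `E_α = E_{α,1}`. -/
noncomputable def mittagLeffler (α β : ℝ) (x : ℝ) : ℝ :=
  ∑' k : ℕ, x ^ k / Real.Gamma (α * k + β)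

open Filter Topology MeasureTheory

theorem Real.Gamma_div_Gamma_add_le {α z : ℝ} (hα : α ∈ Set.Ioo (0 : ℝ) 1) (hz : α ≤ z) :
    Real.Gamma z / Real.Gamma (z + α) ≤ 2 * z ^ (-α) := by
  obtain ⟨h0, h1⟩ := hα
  have hz0 : 0 < z := h0.trans_le hz
  have hG : 0 < Real.Gamma (z + α) := Real.Gamma_pos_of_pos (by linarith)
  have key := Real.Gamma_mul_add_mul_le_rpow_Gamma_mul_rpow_Gamma (s := z + α) (t := z + α + 1)
    (a := α) (b := 1 - α) (by linarith) (by linarith) h0 (by linarith) (by ring)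
  rw [show α * (z + α) + (1 - α) * (z + α + 1) = z + 1 by ring,
    Real.Gamma_add_one hz0.ne', Real.Gamma_add_one (s := z + α) (by linarith),
    Real.mul_rpow (by linarith) hG.le, mul_left_comm, ← Real.rpow_add hG,
    add_sub_cancel, Real.rpow_one] at key
  have h2 : (z + α) ^ (1 - α) ≤ 2 * (z * z ^ (-α)) := by
    calc (z + α) ^ (1 - α) ≤ (2 * z) ^ (1 - α) :=
          Real.rpow_le_rpow (by linarith) (by linarith) (by linarith)
      _ = 2 ^ (1 - α) * z ^ (1 - α) := Real.mul_rpow (by norm_num) hz0.le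
      _ ≤ 2 ^ (1 : ℝ) * z ^ (1 - α) := by
          gcongr
          · norm_num
          · linarith
      _ = 2 * (z * z ^ (-α)) := by
          rw [Real.rpow_one, sub_eq_add_neg, Real.rpow_add hz0, Real.rpow_one]
  rw [div_le_iff₀ hG]
  have h3 := mul_le_mul_of_nonneg_right h2 hG.le
  nlinarith

theorem summable_pow_div_Gamma {α : ℝ} (hα : α ∈ Set.Ioo (0 : ℝ) 1) {R : ℝ} (hR : 0 < R) :
    Summable fun k : ℕ => R ^ k / Real.Gamma (α * k + α) := by
  have h0 := hα.1
  have hG : ∀ k : ℕ, 0 < Real.Gamma (α * k + α) := fun k => Real.Gamma_pos_of_pos (by positivity)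
  refine summable_of_ratio_test_tendsto_lt_one zero_lt_one
    (.of_forall fun k => (div_pos (pow_pos hR k) (hG k)).ne') ?_
  have hz : Tendsto (fun k : ℕ => α * (k : ℝ) + α) atTop atTop :=
    tendsto_atTop_add_const_right _ _ (tendsto_natCast_atTop_atTop.const_mul_atTop h0)
  have hlim : Tendsto (fun k : ℕ => R * (2 * (α * (k : ℝ) + α) ^ (-α))) atTop (𝓝 0) := by
    simpa using (((tendsto_rpow_neg_atTop h0).comp hz).const_mul 2).const_mul R
  refine squeeze_zero (fun k => by positivity) (fun k => ?_) hlim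
  have hk := Real.Gamma_div_Gamma_add_le hα (z := α * k + α)
    (le_add_of_nonneg_left (by positivity))
  rw [Real.norm_of_nonneg (div_pos (pow_pos hR _) (hG _)).le,
    Real.norm_of_nonneg (div_pos (pow_pos hR _) (hG _)).le]
  have e : α * ((k + 1 : ℕ) : ℝ) + α = α * k + α + α := by push_cast; ring
  have h1 := (hG k).ne'
  have h2 := (hG (k + 1)).ne'
  rw [e] at h2 ⊢
  calc _ = R * (Real.Gamma (α * k + α) / Real.Gamma (α * k + α + α)) := by
        rw [pow_succ]; field_simp
    _ ≤ _ := by gcongr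

theorem Summable.natCast_mul_mul_pow {a : ℕ → ℝ}
    (ha : ∀ R : ℝ, 0 < R → Summable fun k => |a k| * R ^ k) (R : ℝ) (hR : 0 < R) :
    Summable fun k : ℕ => |k * a k| * R ^ k := by
  refine .of_nonneg_of_le (fun k => by positivity) (fun k => ?_) (ha (2 * R) (by positivity))
  rw [abs_mul, Nat.abs_cast, mul_pow]
  have : (k : ℝ) ≤ 2 ^ k := by exact_mod_cast Nat.lt_two_pow_self.le
  calc (k : ℝ) * |a k| * R ^ k ≤ 2 ^ k * |a k| * R ^ k := by gcongr
    _ = _ := by ring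

theorem hasDerivAt_tsum_mul_pow {a : ℕ → ℝ}
    (ha : ∀ R : ℝ, 0 < R → Summable fun k => |a k| * R ^ k) (y : ℝ) :
    HasDerivAt (fun y => ∑' k, a k * y ^ k) (∑' k : ℕ, a k * (k * y ^ (k - 1))) y := by
  set R := |y| + 1 with hR
  have hR1 : 1 ≤ R := by simp [hR]
  refine hasDerivAt_tsum_of_isPreconnected
    (Summable.natCast_mul_mul_pow ha R (by positivity)) (t := Metric.ball 0 R)
    Metric.isOpen_ball (convex_ball 0 R).isPreconnected
    (fun k z _ => (hasDerivAt_pow k z).const_mul (a k)) (fun k z hz => ?_) (y₀ := 0)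
    (by simp; linarith) ?_ (by simp [hR])
  · rw [mem_ball_zero_iff, Real.norm_eq_abs] at hz
    rw [Real.norm_eq_abs, abs_mul, abs_mul, abs_mul, abs_pow, mul_left_comm, ← mul_assoc]
    gcongr
    calc |z| ^ (k - 1) ≤ R ^ (k - 1) := by gcongr
      _ ≤ R ^ k := pow_le_pow_right₀ hR1 (Nat.sub_le _ _)
  · refine summable_of_ne_finset_zero (s := {0}) fun k hk => ?_
    simp [zero_pow (show k ≠ 0 by simpa using hk)]

theorem continuous_tsum_mul_pow {a : ℕ → ℝ}
    (ha : ∀ R : ℝ, 0 < R → Summable fun k => |a k| * R ^ k) :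
    Continuous fun y => ∑' k, a k * y ^ k :=
  continuous_iff_continuousAt.2 fun y => (hasDerivAt_tsum_mul_pow ha y).continuousAt

theorem Real.intervalIntegrable_rpow_mul_one_sub_rpow {u v : ℝ} (hu : 0 < u) (hv : 0 < v) :
    IntervalIntegrable (fun s : ℝ => s ^ (u - 1) * (1 - s) ^ (v - 1)) volume 0 1 := by
  have h := Complex.betaIntegral_convergent (u := u) (v := v) (by simpa) (by simpa)
  rw [intervalIntegrable_iff_integrableOn_Ioc_of_le zero_le_one] at h ⊢
  refine IntegrableOn.congr_fun h.re (fun s hs => ?_) measurableSet_Ioc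
  have h1 : (s : ℂ) ^ ((u : ℂ) - 1) = ((s ^ (u - 1) : ℝ) : ℂ) := by
    rw [Complex.ofReal_cpow hs.1.le]; push_cast; rfl
  have h2 : (1 - (s : ℂ)) ^ ((v : ℂ) - 1) = (((1 - s) ^ (v - 1) : ℝ) : ℂ) := by
    rw [Complex.ofReal_cpow (by linarith [hs.2])]; push_cast; rfl
  simp only [h1, h2, ← Complex.ofReal_mul]
  exact Complex.ofReal_re _

theorem Real.integral_rpow_mul_one_sub_rpow {u v : ℝ} (hu : 0 < u) (hv : 0 < v) :
    ∫ s in (0 : ℝ)..1, s ^ (u - 1) * (1 - s) ^ (v - 1) =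
      Real.Gamma u * Real.Gamma v / Real.Gamma (u + v) := by
  have h := Complex.betaIntegral_eq_Gamma_mul_div u v (by simpa) (by simpa)
  rw [← Complex.ofReal_inj, ← intervalIntegral.integral_ofReal]
  push_cast
  rw [← Complex.Gamma_ofReal, ← Complex.Gamma_ofReal, ← Complex.Gamma_ofReal]
  push_cast
  rw [← h, Complex.betaIntegral]
  refine intervalIntegral.integral_congr fun s hs => ?_
  rw [Set.uIcc_of_le zero_le_one] at hs
  rw [Complex.ofReal_cpow hs.1, Complex.ofReal_cpow (by linarith [hs.2])]
  push_cast
  rfl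

/-- Termwise integration of a power series in `s ^ α` against the Beta weight. -/
theorem hasSum_integral_beta_mul_tsum {α : ℝ} (hα : α ∈ Set.Ioo (0 : ℝ) 1) {a : ℕ → ℝ}
    (ha : Summable fun k => |a k|) :
    HasSum (fun k : ℕ => a k * (Real.Gamma (α * k + α) * Real.Gamma (1 - α) /
        Real.Gamma (α * k + 1)))
      (∫ s in (0 : ℝ)..1, s ^ (α - 1) * (1 - s) ^ (-α) * ∑' k, a k * (s ^ α) ^ k) := by
  obtain ⟨h0, h1⟩ := hα
  have hw := Real.intervalIntegrable_rpow_mul_one_sub_rpow h0 (sub_pos.2 h1)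
  rw [show 1 - α - 1 = -α by ring] at hw
  have hle : ∀ s ∈ Set.Ioc (0 : ℝ) 1, ∀ k, |a k * (s ^ α) ^ k| ≤ |a k| := fun s hs k => by
    rw [abs_mul, abs_pow, abs_of_nonneg (Real.rpow_nonneg hs.1.le _)]
    exact mul_le_of_le_one_right (abs_nonneg _)
      (pow_le_one₀ (Real.rpow_nonneg hs.1.le _) (Real.rpow_le_one hs.1.le hs.2 h0.le))
  have key := intervalIntegral.hasSum_integral_of_dominated_convergence (μ := volume)
    (a := (0 : ℝ)) (b := 1)
    (F := fun k s => s ^ (α - 1) * (1 - s) ^ (-α) * (a k * (s ^ α) ^ k))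
    (f := fun s => s ^ (α - 1) * (1 - s) ^ (-α) * ∑' k, a k * (s ^ α) ^ k)
    (fun k s => |a k| * (s ^ (α - 1) * (1 - s) ^ (-α)))
    (fun k => Measurable.aestronglyMeasurable (by fun_prop))
    (fun k => .of_forall fun s hs => ?_) (.of_forall fun s hs => ha.mul_right _) ?_
    (.of_forall fun s hs => ?_)
  · refine (congrArg (fun g => HasSum g _) (funext fun k => ?_)).mpr key
    have hk : 0 < α * k + α := by positivity
    have hB := Real.integral_rpow_mul_one_sub_rpow hk (sub_pos.2 h1)
    rw [show α * k + α + (1 - α) = α * k + 1 by ring, show 1 - α - 1 = -α by ring] at hB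
    rw [← hB, ← intervalIntegral.integral_const_mul]
    refine intervalIntegral.integral_congr_ae (.of_forall fun s hs => ?_)
    rw [Set.uIoc_of_le zero_le_one] at hs
    rw [add_sub_assoc, Real.rpow_add hs.1, Real.rpow_mul hs.1.le, Real.rpow_natCast]
    ring
  · rw [Set.uIoc_of_le zero_le_one] at hs
    have hp : 0 ≤ s ^ (α - 1) * (1 - s) ^ (-α) :=
      mul_nonneg (Real.rpow_nonneg hs.1.le _) (Real.rpow_nonneg (by linarith [hs.2]) _)
    rw [Real.norm_eq_abs, abs_mul, abs_of_nonneg hp, mul_comm]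
    exact mul_le_mul_of_nonneg_right (hle s hs k) hp
  · simp_rw [tsum_mul_right]
    exact hw.const_mul _
  · rw [Set.uIoc_of_le zero_le_one] at hs
    have hsum : Summable fun k => a k * (s ^ α) ^ k := .of_norm_bounded ha (hle s hs)
    exact hsum.hasSum.mul_left _

theorem summable_abs_mittagLeffler_coeff {α : ℝ} (hα : α ∈ Set.Ioo (0 : ℝ) 1) (x R : ℝ)
    (hR : 0 < R) : Summable fun k : ℕ => |(-x) ^ k / Real.Gamma (α * k + α)| * R ^ k := by
  have h0 := hα.1
  have hG : ∀ k : ℕ, 0 < Real.Gamma (α * k + α) := fun k => Real.Gamma_pos_of_pos (by positivity)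
  refine .of_nonneg_of_le (fun k => by positivity) (fun k => ?_)
    (summable_pow_div_Gamma hα (R := (|x| + 1) * R) (by positivity))
  rw [abs_div, abs_pow, abs_neg, abs_of_pos (hG k), mul_pow, div_mul_eq_mul_div]
  have := hG k
  gcongr
  linarith

theorem tsum_coeff_mul_pow_eq_mittagLeffler (α x y : ℝ) :
    ∑' k : ℕ, (-x) ^ k / Real.Gamma (α * k + α) * y ^ k = mittagLeffler α α (-(x * y)) := by
  refine tsum_congr fun k => ?_
  rw [← neg_mul, mul_pow]
  ring

theorem continuous_mittagLeffler_neg {α : ℝ} (hα : α ∈ Set.Ioo (0 : ℝ) 1) :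
    Continuous fun x => mittagLeffler α α (-x) := by
  simpa only [tsum_coeff_mul_pow_eq_mittagLeffler, one_mul] using
    continuous_tsum_mul_pow (summable_abs_mittagLeffler_coeff hα 1)

theorem integral_beta_mul_mittagLeffler {α : ℝ} (hα : α ∈ Set.Ioo (0 : ℝ) 1) (x : ℝ) :
    ∫ s in (0 : ℝ)..1, s ^ (α - 1) * (1 - s) ^ (-α) * mittagLeffler α α (-(x * s ^ α)) =
      Real.Gamma (1 - α) * mittagLeffler α 1 (-x) := by
  have h0 := hα.1
  have h := hasSum_integral_beta_mul_tsum hα (a := fun k => (-x) ^ k / Real.Gamma (α * k + α))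
    (by simpa using summable_abs_mittagLeffler_coeff hα x 1 one_pos)
  simp only [tsum_coeff_mul_pow_eq_mittagLeffler] at h
  rw [← h.tsum_eq, mittagLeffler, ← tsum_mul_left]
  refine tsum_congr fun k => ?_
  have := (Real.Gamma_pos_of_pos (show 0 < α * k + α by positivity)).ne'
  field_simp

theorem integral_beta_mul_tsum_natCast_mul {α : ℝ} (hα : α ∈ Set.Ioo (0 : ℝ) 1) (x : ℝ) :
    α * ∫ s in (0 : ℝ)..1, s ^ (α - 1) * (1 - s) ^ (-α) *
        ∑' k : ℕ, k * ((-x) ^ k / Real.Gamma (α * k + α)) * (s ^ α) ^ k =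
      Real.Gamma (1 - α) * (-x * mittagLeffler α α (-x)) := by
  have h0 := hα.1
  have h := hasSum_integral_beta_mul_tsum hα
    (a := fun k => k * ((-x) ^ k / Real.Gamma (α * k + α)))
    (by simpa using Summable.natCast_mul_mul_pow (summable_abs_mittagLeffler_coeff hα x) 1 one_pos)
  rw [← h.tsum_eq, h.summable.tsum_eq_zero_add]
  simp only [Nat.cast_zero, zero_mul, zero_add]
  rw [mittagLeffler, ← tsum_mul_left, ← tsum_mul_left, ← tsum_mul_left]
  refine tsum_congr fun k => ?_
  have h1 := (Real.Gamma_pos_of_pos (show 0 < α * k + α by positivity)).ne'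
  have h2 := (Real.Gamma_pos_of_pos (show 0 < α * (k + 1 : ℕ) + α by positivity)).ne'
  have h3 : α * ((k : ℝ) + 1) ≠ 0 := by positivity
  rw [show α * ((k + 1 : ℕ) : ℝ) + 1 = α * (k + 1) + 1 by push_cast; ring,
    Real.Gamma_add_one h3, show α * ((k : ℝ) + 1) = α * k + α by ring]
  have h4 : α * (k : ℝ) + α ≠ 0 := by positivity
  push_cast at h2 ⊢
  field_simp
  ring

/-- The two-parameter function `E_{α,α}` has no first zero on the negative half-line. -/
theorem mittagLeffler_self_neg_ne_zero_of_pos_on {α : ℝ} (hα : α ∈ Set.Ioo (0 : ℝ) 1) {x : ℝ}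
    (hx : 0 < x) (hpos : ∀ y, 0 ≤ y → y < x → 0 < mittagLeffler α α (-y)) :
    mittagLeffler α α (-x) ≠ 0 := by
  intro hzero
  obtain ⟨h0, h1⟩ := id hα
  set a : ℕ → ℝ := fun k => (-x) ^ k / Real.Gamma (α * k + α)
  have ha := summable_abs_mittagLeffler_coeff hα x
  set P : ℝ → ℝ := fun y => ∑' k, a k * y ^ k
  set Q : ℝ → ℝ := fun y => ∑' k : ℕ, k * a k * y ^ k
  have hPE : ∀ y, P y = mittagLeffler α α (-(x * y)) :=
    tsum_coeff_mul_pow_eq_mittagLeffler α x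
  have hQc : Continuous Q := continuous_tsum_mul_pow (Summable.natCast_mul_mul_pow ha)
  have hPQ : ∀ y, ∃ p', HasDerivAt P p' y ∧ y * p' = Q y := fun y => by
    refine ⟨_, hasDerivAt_tsum_mul_pow ha y, ?_⟩
    rw [← tsum_mul_left]
    refine tsum_congr fun k => ?_
    rcases k with _ | k
    · simp
    · simp only [Nat.add_sub_cancel]; ring
  have hPd : Differentiable ℝ P := fun y => (hasDerivAt_tsum_mul_pow ha y).differentiableAt
  have hw := Real.intervalIntegrable_rpow_mul_one_sub_rpow h0 (sub_pos.2 h1)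
  rw [show 1 - α - 1 = -α by ring] at hw
  have hrc : Continuous fun s : ℝ => s ^ α := Real.continuous_rpow_const h0.le
  have hint : IntervalIntegrable (fun s : ℝ => s ^ (α - 1) * (1 - s) ^ (-α) * Q (s ^ α))
      volume 0 1 := hw.mul_continuousOn (hQc.comp hrc).continuousOn
  set φ : ℝ → ℝ := fun r =>
    α * (∫ s in (0 : ℝ)..r, s ^ (α - 1) * (1 - s) ^ (-α) * Q (s ^ α)) -
      r ^ α * (1 - r) ^ (-α) * P (r ^ α) with hφ
  have hP1 : P 1 = 0 := by rw [hPE, mul_one, hzero]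
  have hφ0 : φ 0 = 0 := by simp [hφ, Real.zero_rpow h0.ne']
  have hφ1 : φ 1 = 0 := by
    have := integral_beta_mul_tsum_natCast_mul hα x
    rw [hzero, mul_zero, mul_zero] at this
    simp only [hφ, Real.one_rpow, hP1, mul_zero, sub_zero]
    exact this
  -- the boundary term vanishes at `1`, as seen by factoring `1 - r` out of `P (r ^ α)`
  have hbdry : ContinuousOn (fun r : ℝ => r ^ α * (1 - r) ^ (-α) * P (r ^ α)) (Set.Icc 0 1) := by
    set G : ℝ → ℝ := fun r => P (r ^ α) with hG
    have hGd : DifferentiableAt ℝ G 1 :=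
      (hPd _).comp (1 : ℝ) (Real.differentiableAt_rpow_const_of_ne α one_ne_zero)
    have hGc : Continuous G := hPd.continuous.comp hrc
    have hds : Continuous (dslope G 1) := by
      refine continuous_iff_continuousAt.2 fun r => ?_
      rcases eq_or_ne r 1 with rfl | hr
      · exact continuousAt_dslope_same.2 hGd
      · exact (continuousAt_dslope_of_ne hr).2 hGc.continuousAt
    have hc : Continuous fun r : ℝ => -(r ^ α * (1 - r) ^ (1 - α) * dslope G 1 r) :=
      ((hrc.mul ((Real.continuous_rpow_const (sub_pos.2 h1).le).comp
        (continuous_const.sub continuous_id))).mul hds).neg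
    refine hc.continuousOn.congr fun r hr => ?_
    have hGr : G r = (r - 1) * dslope G 1 r := by
      have := sub_smul_dslope G 1 r
      rw [smul_eq_mul] at this
      rw [this]; simp [hG, hP1]
    change r ^ α * (1 - r) ^ (-α) * G r = _
    rcases eq_or_lt_of_le hr.2 with rfl | hr1
    · simp [hGr, Real.zero_rpow (sub_pos.2 h1).ne']
    · simp only
      rw [hGr, sub_eq_add_neg 1 α, Real.rpow_add (sub_pos.2 hr1), Real.rpow_one]
      ring
  have hφc : ContinuousOn φ (Set.Icc 0 1) := by
    refine ContinuousOn.sub (continuousOn_const.mul ?_) hbdry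
    have := intervalIntegral.continuousOn_primitive_interval (μ := volume) (a := (0 : ℝ)) (b := 1)
      (f := fun s : ℝ => s ^ (α - 1) * (1 - s) ^ (-α) * Q (s ^ α))
      (by
        rw [Set.uIcc_of_le zero_le_one]
        rwa [intervalIntegrable_iff_integrableOn_Icc_of_le zero_le_one] at hint)
    rwa [Set.uIcc_of_le zero_le_one] at this
  have hφ' : ∀ r ∈ interior (Set.Icc (0 : ℝ) 1), deriv φ r < 0 := by
    rw [interior_Icc]
    rintro r ⟨hr0, hr1⟩
    have hr1' : 0 < 1 - r := sub_pos.2 hr1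
    obtain ⟨p', hp', hpQ⟩ := hPQ (r ^ α)
    have hd1 : HasDerivAt (fun r : ℝ => r ^ α) (α * r ^ (α - 1)) r :=
      Real.hasDerivAt_rpow_const (.inl hr0.ne')
    have hd2 : HasDerivAt (fun r : ℝ => (1 - r) ^ (-α)) (-1 * (-α) * (1 - r) ^ (-α - 1)) r :=
      ((hasDerivAt_id r).const_sub 1).rpow_const (.inl hr1'.ne')
    have hd3 : HasDerivAt (fun r : ℝ => P (r ^ α)) (p' * (α * r ^ (α - 1))) r :=
      HasDerivAt.comp (h₂ := P) r hp' hd1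
    have hd4 : HasDerivAt (fun r => ∫ s in (0 : ℝ)..r, s ^ (α - 1) * (1 - s) ^ (-α) * Q (s ^ α))
        (r ^ (α - 1) * (1 - r) ^ (-α) * Q (r ^ α)) r := by
      refine intervalIntegral.integral_hasDerivAt_right (hint.mono_set ?_) ?_ ?_
      · rw [Set.uIcc_of_le hr0.le, Set.uIcc_of_le zero_le_one]
        exact Set.Icc_subset_Icc_right hr1.le
      · exact (((by fun_prop : Measurable fun s : ℝ => s ^ (α - 1) * (1 - s) ^ (-α)).mul
          (hQc.comp hrc).measurable).stronglyMeasurable).stronglyMeasurableAtFilter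
      · exact ((Real.continuousAt_rpow_const _ _ (.inl hr0.ne')).mul
          hd2.continuousAt).mul (hQc.comp hrc).continuousAt
    have hd : HasDerivAt φ _ r := (hd4.const_mul α).sub ((hd1.mul hd2).mul hd3)
    rw [hd.deriv]
    have hPr : 0 < P (r ^ α) := by
      rw [hPE]
      refine hpos _ (by positivity) ?_
      exact mul_lt_of_lt_one_right hx (Real.rpow_lt_one hr0.le hr1 h0)
    have e : α * (r ^ (α - 1) * (1 - r) ^ (-α) * Q (r ^ α)) =
        r ^ α * (1 - r) ^ (-α) * (p' * (α * r ^ (α - 1))) := by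
      rw [← hpQ]; ring
    rw [e]
    have : 0 < (α * r ^ (α - 1) * (1 - r) ^ (-α) +
        r ^ α * (-1 * (-α) * (1 - r) ^ (-α - 1))) * P (r ^ α) := by
      rw [neg_one_mul, neg_neg]
      positivity
    simp only [Pi.mul_apply]
    linarith
  have := strictAntiOn_of_deriv_neg (convex_Icc 0 1) hφc hφ' (Set.left_mem_Icc.2 zero_le_one)
    (Set.right_mem_Icc.2 zero_le_one) zero_lt_one
  rw [hφ0, hφ1] at this
  exact lt_irrefl _ this

theorem mittagLeffler_self_neg_pos {α : ℝ} (hα : α ∈ Set.Ioo (0 : ℝ) 1) {x : ℝ} (hx : 0 ≤ x) :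
    0 < mittagLeffler α α (-x) := by
  set f : ℝ → ℝ := fun x => mittagLeffler α α (-x) with hf
  have hc : Continuous f := continuous_mittagLeffler_neg hα
  have hf0 : 0 < f 0 := by
    have : f 0 = 1 / Real.Gamma α := by
      simp only [hf, mittagLeffler, neg_zero]
      rw [tsum_eq_single 0 fun k hk => by simp [zero_pow hk]]
      simp
    rw [this]
    exact one_div_pos.2 (Real.Gamma_pos_of_pos hα.1)
  by_contra! hneg
  have hK : IsCompact (Set.Icc 0 x ∩ f ⁻¹' Set.Iic 0) :=
    isCompact_Icc.inter_right (isClosed_Iic.preimage hc)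
  obtain ⟨m, ⟨⟨hm0, hmx⟩, hmf⟩, hmin⟩ := hK.exists_isLeast ⟨x, ⟨hx, le_rfl⟩, hneg⟩
  have hm : 0 < m := hm0.lt_of_ne (by rintro rfl; exact absurd hmf (not_le.2 hf0))
  have hpos : ∀ y, 0 ≤ y → y < m → 0 < f y := fun y hy hym => by
    by_contra! hyf
    exact absurd (hmin ⟨⟨hy, hym.le.trans hmx⟩, hyf⟩) (not_le.2 hym)
  have hge : 0 ≤ f m := by
    refine ge_of_tendsto (hc.continuousAt.tendsto.mono_left nhdsWithin_le_nhds :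
      Tendsto f (𝓝[<] m) (𝓝 (f m))) ?_
    filter_upwards [Ioo_mem_nhdsLT hm] with y hy using (hpos y hy.1.le hy.2).le
  exact mittagLeffler_self_neg_ne_zero_of_pos_on hα hm hpos (le_antisymm hmf hge)

theorem mittagLeffler_one_neg_pos {α : ℝ} (hα : α ∈ Set.Ioo (0 : ℝ) 1) {x : ℝ} (hx : 0 ≤ x) :
    0 < mittagLeffler α 1 (-x) := by
  obtain ⟨h0, h1⟩ := id hα
  refine pos_of_mul_pos_right ?_ (Real.Gamma_pos_of_pos (sub_pos.2 h1)).le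
  rw [← integral_beta_mul_mittagLeffler hα x]
  have hw := Real.intervalIntegrable_rpow_mul_one_sub_rpow h0 (sub_pos.2 h1)
  rw [show 1 - α - 1 = -α by ring] at hw
  refine intervalIntegral.intervalIntegral_pos_of_pos_on (hw.mul_continuousOn
    ((continuous_mittagLeffler_neg hα).comp
      (continuous_const.mul (Real.continuous_rpow_const h0.le))).continuousOn)
    (fun s hs => ?_) zero_lt_one
  have h2 : 0 < 1 - s := sub_pos.2 hs.2
  have h3 := hs.1
  have := mittagLeffler_self_neg_pos hα (x := x * s ^ α) (by positivity)
  positivity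

/-- Let `α ∈ (0,1)`, `τ₀ > 0`, and
`τ(s) = τ₀ E_α(-(s/τ₀)^α) / ((s/τ₀)^(α-1) E_{α,α}(-(s/τ₀)^α))` for `s > 0`.
Then `τ(s)` is a well-defined (the denominator is nonzero), finite, strictly
positive real number for every `s > 0`. -/
theorem nonlinear_relaxation_time_pos (α τ₀ : ℝ) (hα : α ∈ Set.Ioo (0 : ℝ) 1)
    (hτ : 0 < τ₀) (s : ℝ) (hs : 0 < s) :
    (s / τ₀) ^ (α - 1) * mittagLeffler α α (-((s / τ₀) ^ α)) ≠ 0 ∧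
    0 < τ₀ * mittagLeffler α 1 (-((s / τ₀) ^ α)) /
      ((s / τ₀) ^ (α - 1) * mittagLeffler α α (-((s / τ₀) ^ α))) := by
  have hx : 0 < s / τ₀ := div_pos hs hτ
  have h1 := mittagLeffler_one_neg_pos hα (Real.rpow_nonneg hx.le α)
  have h2 := mittagLeffler_self_neg_pos hα (Real.rpow_nonneg hx.le α)
  have h3 := mul_pos (Real.rpow_pos_of_pos hx (α - 1)) h2
  exact ⟨h3.ne', div_pos (mul_pos hτ h1) h3⟩
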